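/- arXiv:1606.00324 — 3 statements merged into one kernel-verified Lean document; each statement's English description precedes it below -/
import Mathlib

section
/- For any hypergraph communication situation (N,v,H) and any player i∈N, the position value satisfies π_i(N,v,H) = Σ_{l∈U(H)(i)} Sh_l(U(H),w), where (U(H),w) is the uniform hyperlink game of (N,v,H). -/
open scoped Classical
open Finset

noncomputable section

namespace HGGame

/-! ## Generic hypergraph notions -/

variable {α : Type*}

/-- Two nodes are linked if they lie in a common hyperlink of `E`. -/
def Linked (E : Finset (Finset α)) (a b : α) : Prop :=
  ∃ e ∈ E, a ∈ e ∧ b ∈ e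

/-- The component of `i` in the subhypergraph of `(α, E)` induced by the ground set `S`
(only hyperlinks contained in `S` count). -/
def compOf (E : Finset (Finset α)) (S : Finset α) (i : α) : Finset α :=
  S.filter (fun j => Relation.ReflTransGen (Linked (E.filter (fun e => e ⊆ S))) i j)

/-- The set `S/E` of components of the subhypergraph induced by `S`. -/
def components (E : Finset (Finset α)) (S : Finset α) : Finset (Finset α) :=
  S.image (compOf E S)

/-- The hypergraph-restricted worth `v^E(S) = Σ_{T ∈ S/E} v(T)`. -/
def restrictedWorth (v : Finset α → ℝ) (E : Finset (Finset α)) (S : Finset α) : ℝ :=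
  ∑ T ∈ components E S, v T

/-! ## Shapley value -/

/-- The set `σ^i` of players preceding `i` in the ordering `σ`. -/
def preceding {M : Type*} [Fintype M] (σ : M ≃ Fin (Fintype.card M)) (i : M) : Finset M :=
  Finset.univ.filter (fun j => σ j < σ i)

/-- The marginal contribution `m^σ_i(u) = u(σ^i ∪ {i}) - u(σ^i)`. -/
def marginal {M : Type*} [Fintype M] (u : Finset M → ℝ) (σ : M ≃ Fin (Fintype.card M))
    (i : M) : ℝ :=
  u (insert i (preceding σ i)) - u (preceding σ i)

/-- The Shapley value of the TU-game `(M, u)`. -/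
def shapley {M : Type*} [Fintype M] (u : Finset M → ℝ) (i : M) : ℝ :=
  ((Fintype.card M).factorial : ℝ)⁻¹ * ∑ σ : M ≃ Fin (Fintype.card M), marginal u σ i

/-- The Harsanyi dividend `λ_T(u) = Σ_{∅ ≠ S ⊆ T} (-1)^{|T|-|S|} u(S)`. -/
def dividend {M : Type*} (u : Finset M → ℝ) (T : Finset M) : ℝ :=
  ∑ S ∈ T.powerset.filter (fun S => S ≠ ∅), (-1 : ℝ) ^ (T.card - S.card) * u S

/-! ## Hypergraph communication situations -/

variable {N : Type*} [Fintype N] [DecidableEq N]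

/-- The conference game `(H, v^N)`, a TU-game with player set `H`:
`v^N(H') = Σ_{T ∈ N/H'} v(T)`. -/
def confGame (v : Finset N → ℝ) (H : Finset (Finset N)) (F : Finset {e // e ∈ H}) : ℝ :=
  restrictedWorth v (F.image Subtype.val) Finset.univ

/-- The position value `π_i(N,v,H) = Σ_{e ∈ H_i} (1/|e|) · Sh_e(H, v^N)`. -/
def positionValue (v : Finset N → ℝ) (H : Finset (Finset N)) (i : N) : ℝ :=
  ∑ e ∈ H.attach.filter (fun e => i ∈ e.val),
    ((e.val.card : ℝ))⁻¹ * shapley (confGame v H) e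

/-! ## The uniform hyperlink game -/

/-- The type of agents `(i, e, k)` of the uniform hyperlink game. -/
abbrev UElem (N : Type*) := N × Finset N × ℕ

/-- `η(H)`: the least common multiple of the hyperlink sizes. -/
def eta (H : Finset (Finset N)) : ℕ := H.lcm Finset.card

/-- `U(H)(i,e) = {(i,e,k) : k = 1, …, η(H)/|e|}`. -/
def UHie (H : Finset (Finset N)) (i : N) (e : Finset N) : Finset (UElem N) :=
  (Finset.Icc 1 (eta H / e.card)).image fun k => (i, e, k)

/-- `U(H)(i) = ∪_{e ∈ H_i} U(H)(i,e)`. -/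
def UHi (H : Finset (Finset N)) (i : N) : Finset (UElem N) :=
  (H.filter (fun e => i ∈ e)).biUnion fun e => UHie H i e

/-- `U(H)(e) = ∪_{i ∈ e} U(H)(i,e)`. -/
def UHe (H : Finset (Finset N)) (e : Finset N) : Finset (UElem N) :=
  e.biUnion fun i => UHie H i e

/-- `U(H) = ∪_{i ∈ N} U(H)(i)`. -/
def UH (H : Finset (Finset N)) : Finset (UElem N) :=
  Finset.univ.biUnion fun i : N => UHi H i

/-- `H[S] = {e ∈ H : U(H)(e) ⊆ S}`. -/
def Hof (H : Finset (Finset N)) (S : Finset (UElem N)) : Finset (Finset N) :=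
  H.filter fun e => UHe H e ⊆ S

/-- The characteristic function `w(S) = Σ_{R ∈ N/H[S]} v(R)` of the uniform hyperlink game. -/
def uw (v : Finset N → ℝ) (H : Finset (Finset N)) (S : Finset (UElem N)) : ℝ :=
  restrictedWorth v (Hof H S) Finset.univ

/-- The uniform hyperlink game `(U(H), w)` as a TU-game with player set `U(H)`. -/
def uGame (v : Finset N → ℝ) (H : Finset (Finset N)) (F : Finset {l // l ∈ UH H}) : ℝ :=
  uw v H (F.image Subtype.val)

/-! ## Shapley values of unanimity games -/

section Unanimity

variable {M : Type*} [Fintype M]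

/-- The unanimity game on the coalition `T`. -/
def unanimity (T S : Finset M) : ℝ := if T ⊆ S then 1 else 0

lemma marginal_unanimity_of_notMem {T : Finset M} {i : M} (hi : i ∉ T)
    (σ : M ≃ Fin (Fintype.card M)) : marginal (unanimity T) σ i = 0 := by
  simp [marginal, unanimity, Finset.subset_insert_iff_of_notMem hi]

lemma marginal_unanimity_of_mem {T : Finset M} {i : M} (hi : i ∈ T)
    (σ : M ≃ Fin (Fintype.card M)) :
    marginal (unanimity T) σ i = if ∀ j ∈ T, σ j ≤ σ i then 1 else 0 := by
  have h1 : ¬ T ⊆ preceding σ i := fun h => by simpa [preceding] using h hi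
  have h2 : T ⊆ insert i (preceding σ i) ↔ ∀ j ∈ T, σ j ≤ σ i := by
    refine forall₂_congr fun j _ => ?_
    simp [preceding, le_iff_lt_or_eq, or_comm]
  simp [marginal, unanimity, h1, h2]

/-- In every ordering exactly one member of a nonempty coalition is pivotal. -/
lemma sum_marginal_unanimity {T : Finset M} (hT : T.Nonempty)
    (σ : M ≃ Fin (Fintype.card M)) : ∑ i ∈ T, marginal (unanimity T) σ i = 1 := by
  obtain ⟨m, hm, hmax⟩ := T.exists_max_image σ hT
  rw [Finset.sum_eq_single_of_mem m hm, marginal_unanimity_of_mem hm, if_pos hmax]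
  intro j hj hjm
  rw [marginal_unanimity_of_mem hj, if_neg]
  exact fun h => hjm (σ.injective (le_antisymm (hmax j hj) (h m hm)))

/-- Members of a coalition are symmetric in its unanimity game. -/
lemma sum_marginal_unanimity_eq {T : Finset M} {i j : M} (hi : i ∈ T) (hj : j ∈ T) :
    ∑ σ, marginal (unanimity T) σ i = ∑ σ, marginal (unanimity T) σ j := by
  refine Fintype.sum_equiv (Equiv.equivCongr (Equiv.swap i j) (Equiv.refl _)) _ _ fun σ => ?_
  have hswap : ∀ k ∈ T, Equiv.swap i j k ∈ T := fun k hk => by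
    rw [Equiv.swap_apply_def]; split_ifs <;> assumption
  rw [marginal_unanimity_of_mem hi, marginal_unanimity_of_mem hj]
  refine if_congr ⟨fun h k hk => ?_, fun h k hk => ?_⟩ rfl rfl
  · simpa using h _ (hswap k hk)
  · simpa using h _ (hswap k hk)

lemma shapley_unanimity (T : Finset M) (i : M) :
    shapley (unanimity T) i = if i ∈ T then (T.card : ℝ)⁻¹ else 0 := by
  split_ifs with hi
  · have hsum : (T.card : ℝ) * ∑ σ, marginal (unanimity T) σ i
        = ((Fintype.card M).factorial : ℝ) := by
      rw [← nsmul_eq_mul, ← Finset.sum_const,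
        Finset.sum_congr rfl fun j hj => sum_marginal_unanimity_eq hi hj, Finset.sum_comm]
      simp_rw [sum_marginal_unanimity ⟨i, hi⟩]
      simp [Fintype.card_equiv (Fintype.equivFin M)]
    have hM : ((Fintype.card M).factorial : ℝ) ≠ 0 := by exact_mod_cast Nat.factorial_ne_zero _
    rw [shapley, ← hsum, mul_inv, mul_assoc, inv_mul_cancel₀, mul_one]
    exact right_ne_zero_of_mul (hsum ▸ hM)
  · simp [shapley, marginal_unanimity_of_notMem hi]

lemma shapley_sum_unanimity {ι : Type*} [Fintype ι] (c : ι → ℝ) (B : ι → Finset M) (i : M) :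
    shapley (fun S => ∑ T, c T * unanimity (B T) S) i
      = ∑ T, c T * if i ∈ B T then ((B T).card : ℝ)⁻¹ else 0 := by
  simp_rw [← shapley_unanimity, shapley, marginal, ← Finset.sum_sub_distrib, ← mul_sub]
  rw [Finset.sum_comm]
  simp_rw [← Finset.mul_sum]
  rw [Finset.mul_sum]
  exact Finset.sum_congr rfl fun _ _ => mul_left_comm _ _ _

/-- Every set function is a linear combination of unanimity games. -/
lemma exists_eq_sum_unanimity (u : Finset M → ℝ) :
    ∃ c : Finset M → ℝ, ∀ S, u S = ∑ T, c T * unanimity T S := by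
  let c : Finset M → ℝ := Finset.strongInduction fun T ih =>
    u T - ∑ S ∈ T.ssubsets.attach, ih S.1 (Finset.mem_ssubsets.1 S.2)
  have hc : ∀ T, c T = u T - ∑ S ∈ T.ssubsets, c S := fun T => by
    rw [← Finset.sum_attach]
    exact Finset.strongInduction_eq _ T
  refine ⟨c, fun S => ?_⟩
  have hS : (Finset.univ.filter fun T => T ⊆ S) = insert S S.ssubsets := by
    ext T
    simp [subset_iff_ssubset_or_eq, or_comm]
  simp only [unanimity, mul_ite, mul_one, mul_zero]
  rw [← Finset.sum_filter, hS, Finset.sum_insert (by simp), hc]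
  ring

end Unanimity

/-- The players all of whose agents belong to `S`, where `p` sends agents to players. -/
def activated {L M : Type*} [Fintype M] (p : L → M) (S : Finset L) : Finset M :=
  Finset.univ.filter fun e => ∀ l, p l = e → l ∈ S

lemma mem_activated {L M : Type*} [Fintype M] {p : L → M} {S : Finset L} {e : M} :
    e ∈ activated p S ↔ ∀ l, p l = e → l ∈ S := by
  simp [activated]

/-- If every player of a game is split into `η` symmetric agents, all of whom are needed
to activate the player, then each agent gets the fraction `1 / η` of the player's Shapley value. -/
lemma shapley_split {L M : Type*} [Fintype L] [Fintype M] (p : L → M) (η : ℕ)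
    (hp : ∀ e, (Finset.univ.filter fun l => p l = e).card = η) (u : Finset M → ℝ) (l : L) :
    shapley (fun S => u (activated p S)) l
      = (η : ℝ)⁻¹ * shapley u (p l) := by
  obtain ⟨c, hc⟩ := exists_eq_sum_unanimity u
  have hw : (fun S => u (activated p S))
      = fun S => ∑ T, c T * unanimity (Finset.univ.filter fun l => p l ∈ T) S := by
    funext S
    rw [hc]
    refine Finset.sum_congr rfl fun T _ => ?_
    congr 1
    refine if_congr ⟨fun h l hl => ?_, fun h e he => ?_⟩ rfl rfl
    · exact mem_activated.1 (h (Finset.mem_filter.1 hl).2) l rfl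
    · exact mem_activated.2 fun l hl =>
        h (Finset.mem_filter.2 ⟨Finset.mem_univ _, hl ▸ he⟩)
  have hcard : ∀ T : Finset M, (Finset.univ.filter fun l => p l ∈ T).card = η * T.card := by
    intro T
    rw [Finset.card_eq_sum_card_fiberwise (f := p) (t := T) fun l hl => by simpa using hl,
      mul_comm, ← smul_eq_mul, ← Finset.sum_const]
    refine Finset.sum_congr rfl fun e he => ?_
    rw [← hp e, Finset.filter_filter]
    exact congrArg _ (Finset.filter_congr fun l _ => and_iff_right_of_imp fun h => h ▸ he)
  have hu : shapley u (p l) = ∑ T, c T * if p l ∈ T then (T.card : ℝ)⁻¹ else 0 := by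
    rw [funext hc]
    exact shapley_sum_unanimity c id (p l)
  rw [hw, shapley_sum_unanimity, hu, Finset.mul_sum]
  refine Finset.sum_congr rfl fun T _ => ?_
  simp only [hcard, Finset.mem_filter, Finset.mem_univ, true_and, Nat.cast_mul, mul_inv]
  split_ifs <;> ring

/-! ## Agents of the uniform hyperlink game -/

section Agents

variable {N : Type*} [DecidableEq N] {H : Finset (Finset N)}

lemma mem_UHie {i : N} {e : Finset N} {l : UElem N} :
    l ∈ UHie H i e ↔ l.1 = i ∧ l.2.1 = e ∧ l.2.2 ∈ Finset.Icc 1 (eta H / e.card) := by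
  obtain ⟨a, b, k⟩ := l
  simp only [UHie, Finset.mem_image, Prod.mk.injEq]
  constructor
  · rintro ⟨k, hk, rfl, rfl, rfl⟩
    exact ⟨rfl, rfl, hk⟩
  · rintro ⟨rfl, rfl, hk⟩
    exact ⟨k, hk, rfl, rfl, rfl⟩

lemma mem_UHi {i : N} {l : UElem N} :
    l ∈ UHi H i ↔ ∃ e ∈ H, i ∈ e ∧ l ∈ UHie H i e := by
  simp [UHi, and_assoc]

lemma mem_UHe {e : Finset N} {l : UElem N} : l ∈ UHe H e ↔ l.1 ∈ e ∧ l ∈ UHie H l.1 e := by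
  simp only [UHe, Finset.mem_biUnion]
  constructor
  · rintro ⟨i, hi, hl⟩
    obtain rfl := (mem_UHie.1 hl).1
    exact ⟨hi, hl⟩
  · rintro ⟨hi, hl⟩
    exact ⟨_, hi, hl⟩

lemma link_eq_of_mem_UHe {e : Finset N} {l : UElem N} (hl : l ∈ UHe H e) : l.2.1 = e :=
  (mem_UHie.1 (mem_UHe.1 hl).2).2.1

lemma card_UHie (i : N) (e : Finset N) : (UHie H i e).card = eta H / e.card := by
  rw [UHie, Finset.card_image_of_injective _ fun a b h => by simpa using h]
  simp

lemma card_UHe {e : Finset N} (he : e ∈ H) : (UHe H e).card = eta H := by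
  rw [UHe, Finset.card_biUnion]
  · simp only [card_UHie, Finset.sum_const, smul_eq_mul]
    exact Nat.mul_div_cancel' (Finset.dvd_lcm he)
  · intro i _ j _ hij
    refine Finset.disjoint_left.2 fun l hl hl' => hij ?_
    rw [← (mem_UHie.1 hl).1, (mem_UHie.1 hl').1]

variable [Fintype N]

lemma mem_UH {l : UElem N} : l ∈ UH H ↔ ∃ e ∈ H, l ∈ UHe H e := by
  simp only [UH, UHe, Finset.mem_biUnion, Finset.mem_univ, true_and, mem_UHi]
  constructor
  · rintro ⟨i, e, he, hi, hl⟩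
    exact ⟨e, he, i, hi, hl⟩
  · rintro ⟨e, he, i, hi, hl⟩
    exact ⟨i, e, he, hi, hl⟩

lemma mem_UHe_of_mem_UH {l : UElem N} (hl : l ∈ UH H) : l.2.1 ∈ H ∧ l ∈ UHe H l.2.1 := by
  obtain ⟨e, he, hle⟩ := mem_UH.1 hl
  obtain rfl := link_eq_of_mem_UHe hle
  exact ⟨he, hle⟩

/-- The hyperlink to which an agent of the uniform hyperlink game belongs. -/
def agentLink (l : {l // l ∈ UH H}) : {e // e ∈ H} := ⟨l.1.2.1, (mem_UHe_of_mem_UH l.2).1⟩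

lemma agentLink_eq_iff {l : {l // l ∈ UH H}} {e : {e // e ∈ H}} :
    agentLink l = e ↔ l.1 ∈ UHe H e.1 := by
  constructor
  · rintro rfl
    exact (mem_UHe_of_mem_UH l.2).2
  · exact fun h => Subtype.ext (link_eq_of_mem_UHe h)

lemma card_fiber_agentLink (e : {e // e ∈ H}) :
    (Finset.univ.filter fun l : {l // l ∈ UH H} => agentLink l = e).card = eta H := by
  rw [← card_UHe e.2, ← Finset.card_image_of_injective _ Subtype.val_injective]
  congr 1
  ext l
  simp only [Finset.mem_image, Finset.mem_filter, Finset.mem_univ, true_and, agentLink_eq_iff,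
    Subtype.exists, exists_and_left, exists_prop, exists_eq_right_right, and_iff_left_iff_imp]
  exact fun hl => mem_UH.2 ⟨e.1, e.2, hl⟩

lemma card_fiber_agentLink_UHi {i : N} {e : {e // e ∈ H}} (hi : i ∈ e.1) :
    (((UH H).attach.filter fun l => l.1 ∈ UHi H i).filter fun l => agentLink l = e).card
      = eta H / e.1.card := by
  rw [← card_UHie i, ← Finset.card_image_of_injective _ Subtype.val_injective]
  congr 1
  ext l
  simp only [Finset.mem_image, Finset.mem_filter, Finset.mem_attach, true_and, agentLink_eq_iff]
  constructor
  · rintro ⟨l, ⟨hl, hle⟩, rfl⟩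
    obtain ⟨f, -, -, hlf⟩ := mem_UHi.1 hl
    rwa [← link_eq_of_mem_UHe hle, (mem_UHie.1 hlf).2.1]
  · intro hl
    have hle : l ∈ UHe H e.1 := Finset.mem_biUnion.2 ⟨i, hi, hl⟩
    exact ⟨⟨l, mem_UH.2 ⟨e.1, e.2, hle⟩⟩, ⟨mem_UHi.2 ⟨e.1, e.2, hi, hl⟩, hle⟩, rfl⟩

lemma uGame_eq (v : Finset N → ℝ) :
    uGame v H = fun S => confGame v H (activated agentLink S) := by
  funext S
  unfold uGame uw confGame
  congr 1
  ext e
  simp only [Hof, Finset.mem_filter, Finset.mem_image, mem_activated, agentLink_eq_iff]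
  constructor
  · rintro ⟨he, hS⟩
    refine ⟨⟨e, he⟩, fun l hl => ?_, rfl⟩
    obtain ⟨l', hl', h⟩ := Finset.mem_image.1 (hS hl)
    exact Subtype.ext h ▸ hl'
  · rintro ⟨e, hS, rfl⟩
    refine ⟨e.2, fun l hl => ?_⟩
    exact Finset.mem_image.2 ⟨⟨l, mem_UH.2 ⟨e.1, e.2, hl⟩⟩, hS _ hl, rfl⟩

lemma shapley_uGame (v : Finset N → ℝ) (l : {l // l ∈ UH H}) :
    shapley (uGame v H) l = (eta H : ℝ)⁻¹ * shapley (confGame v H) (agentLink l) := by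
  rw [uGame_eq]
  exact shapley_split agentLink (eta H)
    (fun e => by convert card_fiber_agentLink e) (confGame v H) l

end Agents

/-- Theorem 1: the position value equals the aggregated Shapley value of the
uniform hyperlink game. -/
theorem position_value_eq_uniform_hyperlink_shapley
    {N : Type*} [Fintype N] [DecidableEq N]
    (v : Finset N → ℝ) (H : Finset (Finset N))
    (hN : 2 ≤ Fintype.card N)
    (hv0 : v ∅ = 0) (hzn : ∀ i : N, v {i} = 0)
    (hH : ∀ e ∈ H, 1 < e.card) (i : N) :
    positionValue v H i =
      ∑ l ∈ (UH H).attach.filter (fun l => l.val ∈ UHi H i),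
        shapley (uGame v H) l := by
  have hmaps : ∀ l ∈ (UH H).attach.filter (fun l => l.val ∈ UHi H i),
      agentLink l ∈ H.attach.filter (fun e => i ∈ e.val) := fun l hl => by
    obtain ⟨e, -, hi, hle⟩ := mem_UHi.1 (Finset.mem_filter.1 hl).2
    obtain rfl := (mem_UHie.1 hle).2.1
    exact Finset.mem_filter.2 ⟨Finset.mem_attach _ _, hi⟩
  simp_rw [shapley_uGame]
  rw [positionValue, ← Finset.sum_fiberwise_of_maps_to' hmaps
    fun e => (eta H : ℝ)⁻¹ * shapley (confGame v H) e]
  refine Finset.sum_congr rfl fun e he => ?_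
  have hcard : (e.1.card : ℝ) ≠ 0 := by
    exact_mod_cast (Nat.zero_lt_of_lt (hH e.1 e.2)).ne'
  have heta : (eta H : ℝ) ≠ 0 := by
    refine Nat.cast_ne_zero.2 (Finset.lcm_ne_zero_iff.2 fun f hf => ?_)
    exact (Nat.zero_lt_of_lt (hH f hf)).ne'
  rw [Finset.sum_const, card_fiber_agentLink_UHi (Finset.mem_filter.1 he).2, nsmul_eq_mul,
    Nat.cast_div (show e.1.card ∣ eta H from Finset.dvd_lcm e.2) hcard]
  field_simp

end HGGame
end
end

section
/- The position value satisfies component efficiency: for any hypergraph communication situation (N,v,H) and any component T∈N/H, Σ_{i∈T} π_i(N,v,H) = v(T). -/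
open scoped Classical
open Finset

noncomputable section

namespace HGGame

/-! ## Generic hypergraph notions -/

variable {α : Type*}

/-! ## Hypergraph communication situations -/

variable {N : Type*} [Fintype N] [DecidableEq N]

/-! ## Efficiency and locality of the Shapley value -/

theorem sum_marginal {M : Type*} [Fintype M] (u : Finset M → ℝ)
    (σ : M ≃ Fin (Fintype.card M)) :
    ∑ i, marginal u σ i = u Finset.univ - u ∅ := by
  let f : ℕ → ℝ := fun k => u (Finset.univ.filter fun j => (σ j : ℕ) < k)
  have hf : ∀ i, marginal u σ i = f (σ i + 1) - f (σ i) := by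
    intro i
    have hins : insert i (preceding σ i) =
        Finset.univ.filter fun j => (σ j : ℕ) < σ i + 1 := by
      ext j
      simp only [preceding, Finset.mem_insert, Finset.mem_filter, Finset.mem_univ, true_and,
        Nat.lt_succ_iff, ← σ.injective.eq_iff, Fin.ext_iff, Fin.lt_def]
      omega
    rw [marginal, hins]
    rfl
  simp_rw [hf]
  rw [Equiv.sum_comp σ fun k => f (k + 1) - f k,
    Fin.sum_univ_eq_sum_range fun k => f (k + 1) - f k, Finset.sum_range_sub]
  simp [f]

theorem sum_shapley {M : Type*} [Fintype M] (u : Finset M → ℝ) :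
    ∑ i, shapley u i = u Finset.univ - u ∅ := by
  simp only [shapley]
  rw [← Finset.mul_sum, Finset.sum_comm]
  simp_rw [sum_marginal]
  have hcard : Fintype.card (M ≃ Fin (Fintype.card M)) = (Fintype.card M).factorial :=
    Fintype.card_equiv (Fintype.equivFin M)
  rw [Finset.sum_const, Finset.card_univ, hcard, nsmul_eq_mul, inv_mul_cancel_left₀]
  exact_mod_cast Nat.factorial_ne_zero _

theorem shapley_congr {M : Type*} [Fintype M] [DecidableEq M] {u w : Finset M → ℝ} {i : M}
    (h : ∀ F, u (insert i F) - u F = w (insert i F) - w F) : shapley u i = shapley w i := by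
  have hm : ∀ σ, marginal u σ i = marginal w σ i := fun σ => by
    unfold marginal
    convert h (preceding σ i)
  simp only [shapley, hm]

theorem shapley_eq_zero {M : Type*} [Fintype M] [DecidableEq M] {u : Finset M → ℝ} {i : M}
    (h : ∀ F, u (insert i F) = u F) : shapley u i = 0 := by
  have hm : ∀ σ, marginal u σ i = 0 := fun σ => by
    unfold marginal
    rw [sub_eq_zero]
    convert h (preceding σ i)
  simp [shapley, hm]

/-! ## Components inside a union of components -/

/-- `S` is a union of components of `H`: no hyperlink of `H` crosses its boundary. -/
def IsSaturated (H : Finset (Finset α)) (S : Finset α) : Prop :=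
  ∀ e ∈ H, e ⊆ S ∨ Disjoint e S

/-- The worth of the components of `E` that meet `S`. -/
def partWorth (v : Finset N → ℝ) (E : Finset (Finset N)) (S : Finset N) : ℝ :=
  ∑ R ∈ S.image (compOf E Finset.univ), v R

theorem mem_components {E : Finset (Finset α)} {S R : Finset α} :
    R ∈ components E S ↔ ∃ i ∈ S, compOf E S i = R := by
  simp [components]

theorem mem_compOf_univ [Fintype α] {E : Finset (Finset α)} {i j : α} :
    j ∈ compOf E Finset.univ i ↔ Relation.ReflTransGen (Linked E) i j := by
  simp [compOf]

theorem linked_symm {E : Finset (Finset α)} {i j : α} (h : Linked E i j) : Linked E j i := by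
  obtain ⟨e, he, hi, hj⟩ := h
  exact ⟨e, he, hj, hi⟩

theorem compOf_eq_of_mem [Fintype α] {E : Finset (Finset α)} {i j : α}
    (h : j ∈ compOf E Finset.univ i) :
    compOf E Finset.univ j = compOf E Finset.univ i := by
  rw [mem_compOf_univ] at h
  have h' : Relation.ReflTransGen (Linked E) j i := by
    induction h with
    | refl => exact .refl
    | tail _ hbc ih => exact .head (linked_symm hbc) ih
  ext k
  simp only [mem_compOf_univ]
  exact ⟨h.trans, h'.trans⟩

theorem isSaturated_compOf [Fintype α] (H : Finset (Finset α)) (i : α) :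
    IsSaturated H (compOf H Finset.univ i) := by
  intro e he
  by_contra! hcon
  obtain ⟨hsub, hdis⟩ := hcon
  obtain ⟨a, hae, ha⟩ := Finset.not_disjoint_iff.mp hdis
  refine hsub fun b hb => ?_
  rw [mem_compOf_univ] at ha ⊢
  exact ha.tail ⟨e, he, hae, hb⟩

theorem IsSaturated.compl {H : Finset (Finset N)} {S : Finset N} (hS : IsSaturated H S) :
    IsSaturated H Sᶜ := by
  intro e he
  rcases hS e he with h | h
  · exact Or.inr (disjoint_compl_right.mono_left h)
  · exact Or.inl (Finset.subset_compl_iff_disjoint_right.mpr h)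

theorem IsSaturated.mono {H E : Finset (Finset α)} {S : Finset α} (hS : IsSaturated H S)
    (hE : E ⊆ H) : IsSaturated E S :=
  fun e he => hS e (hE he)

theorem IsSaturated.reachable {E E' : Finset (Finset α)} {S : Finset α}
    (hS : IsSaturated E S) (hEE' : ∀ e ∈ E, e ⊆ S → e ∈ E') {i j : α} (hi : i ∈ S)
    (h : Relation.ReflTransGen (Linked E) i j) :
    j ∈ S ∧ Relation.ReflTransGen (Linked E') i j := by
  induction h with
  | refl => exact ⟨hi, .refl⟩
  | tail _ hbc ih =>
    obtain ⟨e, he, hb, hc⟩ := hbc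
    have hsub : e ⊆ S := (hS e he).resolve_right fun hd =>
      Finset.disjoint_left.mp hd hb ih.1
    exact ⟨hsub hc, ih.2.tail ⟨e, hEE' e he hsub, hb, hc⟩⟩

theorem partWorth_congr (v : Finset N → ℝ) {E E' : Finset (Finset N)} {S : Finset N}
    (hS : IsSaturated E S) (hS' : IsSaturated E' S) (h : ∀ e ⊆ S, e ∈ E ↔ e ∈ E') :
    partWorth v E S = partWorth v E' S := by
  have himage : S.image (compOf E Finset.univ) = S.image (compOf E' Finset.univ) := by
    refine Finset.image_congr fun i hi => ?_
    ext j
    simp only [mem_compOf_univ]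
    exact ⟨fun hj => (hS.reachable (fun e he hs => (h e hs).mp he) hi hj).2,
      fun hj => (hS'.reachable (fun e he hs => (h e hs).mpr he) hi hj).2⟩
  rw [partWorth, partWorth, himage]

theorem restrictedWorth_eq_partWorth_add (v : Finset N → ℝ) {E : Finset (Finset N)}
    {S : Finset N} (hS : IsSaturated E S) :
    restrictedWorth v E Finset.univ = partWorth v E S + partWorth v E Sᶜ := by
  have hdis : Disjoint (S.image (compOf E Finset.univ)) (Sᶜ.image (compOf E Finset.univ)) := by
    rw [Finset.disjoint_left]
    simp only [Finset.mem_image, Finset.mem_compl]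
    rintro _ ⟨i, hi, rfl⟩ ⟨j, hj, hij⟩
    have hmem : j ∈ compOf E Finset.univ i := by
      rw [← hij, mem_compOf_univ]
    exact hj (hS.reachable (fun e he _ => he) hi (mem_compOf_univ.mp hmem)).1
  rw [partWorth, partWorth, ← Finset.sum_union hdis, ← Finset.image_union,
    Finset.union_compl]
  unfold restrictedWorth components
  congr!

theorem partWorth_compOf (v : Finset N → ℝ) (H : Finset (Finset N)) (i : N) :
    partWorth v H (compOf H Finset.univ i) = v (compOf H Finset.univ i) := by
  have himage : (compOf H Finset.univ i).image (compOf H Finset.univ) =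
      {compOf H Finset.univ i} := by
    ext R
    simp only [Finset.mem_image, Finset.mem_singleton]
    constructor
    · rintro ⟨j, hj, rfl⟩
      exact compOf_eq_of_mem hj
    · rintro rfl
      exact ⟨i, mem_compOf_univ.mpr .refl, rfl⟩
  rw [partWorth, himage, Finset.sum_singleton]

theorem partWorth_empty (v : Finset N → ℝ) (hzn : ∀ i : N, v {i} = 0) (S : Finset N) :
    partWorth v ∅ S = 0 := by
  refine Finset.sum_eq_zero fun R hR => ?_
  obtain ⟨i, -, rfl⟩ := Finset.mem_image.mp hR
  have hsingle : compOf (∅ : Finset (Finset N)) Finset.univ i = {i} := by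
    ext j
    rw [mem_compOf_univ, Finset.mem_singleton]
    constructor
    · intro h
      induction h with
      | refl => rfl
      | tail _ hbc _ =>
        obtain ⟨e, he, -⟩ := hbc
        simp at he
    · rintro rfl
      exact .refl
  rw [hsingle, hzn]

/-! ## The conference game on a union of components -/

theorem image_val_subset [DecidableEq α] {H : Finset (Finset α)} (F : Finset {e // e ∈ H}) :
    F.image Subtype.val ⊆ H := by
  intro e he
  obtain ⟨e', -, rfl⟩ := Finset.mem_image.mp he
  exact e'.2

theorem partWorth_insert (v : Finset N → ℝ) {H : Finset (Finset N)} {S : Finset N}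
    (hS : IsSaturated H S) {e : {e // e ∈ H}} (he : ¬ e.val ⊆ S) (F : Finset {e // e ∈ H}) :
    partWorth v ((insert e F).image Subtype.val) S = partWorth v (F.image Subtype.val) S := by
  refine partWorth_congr v (hS.mono (image_val_subset _)) (hS.mono (image_val_subset _))
    fun a ha => ?_
  have hne : a ≠ e.val := by
    rintro rfl
    exact he ha
  rw [Finset.image_insert, Finset.mem_insert, or_iff_right hne]

theorem shapley_partWorth (v : Finset N → ℝ) {H : Finset (Finset N)}
    (hH : ∀ e ∈ H, e.Nonempty) {S : Finset N} (hS : IsSaturated H S) (e : {e // e ∈ H}) :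
    shapley (fun F : Finset {e // e ∈ H} => partWorth v (F.image Subtype.val) S) e =
      if e.val ⊆ S then shapley (confGame v H) e else 0 := by
  split_ifs with he
  · refine shapley_congr fun F => ?_
    have hcompl : ¬ e.val ⊆ Sᶜ := by
      obtain ⟨a, ha⟩ := hH e.val e.2
      exact fun h => Finset.mem_compl.mp (h ha) (he ha)
    unfold confGame
    rw [restrictedWorth_eq_partWorth_add v (hS.mono (image_val_subset (insert e F))),
      restrictedWorth_eq_partWorth_add v (hS.mono (image_val_subset F)),
      partWorth_insert v hS.compl hcompl F]
    ring
  · exact shapley_eq_zero fun F => partWorth_insert v hS he F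

theorem sum_positionValue (v : Finset N → ℝ) {H : Finset (Finset N)}
    (hH : ∀ e ∈ H, e.Nonempty) {S : Finset N} (hS : IsSaturated H S) :
    ∑ i ∈ S, positionValue v H i =
      ∑ e : {e // e ∈ H}, if e.val ⊆ S then shapley (confGame v H) e else 0 := by
  simp only [positionValue, Finset.sum_filter]
  rw [Finset.sum_comm, ← Finset.univ_eq_attach]
  refine Finset.sum_congr rfl fun e _ => ?_
  rw [← Finset.sum_filter, Finset.sum_const, nsmul_eq_mul, Finset.filter_mem_eq_inter]
  have hne := hH e.val e.2
  rcases hS e.val e.2 with he | he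
  · rw [if_pos he, Finset.inter_eq_right.mpr he, mul_inv_cancel_left₀]
    exact_mod_cast hne.card_pos.ne'
  · have hsub : ¬ e.val ⊆ S := fun h => hne.ne_empty (Finset.disjoint_self_iff_empty _ |>.mp
      (he.mono_right h))
    rw [if_neg hsub, Finset.disjoint_iff_inter_eq_empty.mp he.symm]
    simp

/-- Component efficiency of the position value. -/
theorem position_value_component_efficiency
    {N : Type*} [Fintype N] [DecidableEq N]
    (v : Finset N → ℝ) (H : Finset (Finset N))
    (hN : 2 ≤ Fintype.card N)
    (hv0 : v ∅ = 0) (hzn : ∀ i : N, v {i} = 0)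
    (hH : ∀ e ∈ H, 1 < e.card)
    (T : Finset N) (hT : T ∈ components H Finset.univ) :
    ∑ i ∈ T, positionValue v H i = v T := by
  have hne : ∀ e ∈ H, e.Nonempty := fun e he =>
    Finset.card_pos.mp (zero_lt_one.trans (hH e he))
  obtain ⟨i, -, rfl⟩ := mem_components.mp hT
  have hS := isSaturated_compOf H i
  rw [sum_positionValue v hne hS]
  simp_rw [← shapley_partWorth v hne hS]
  have himage : (Finset.univ : Finset {e // e ∈ H}).image Subtype.val = H := by
    rw [Finset.univ_eq_attach, Finset.attach_image_val]
  rw [sum_shapley, himage, Finset.image_empty, partWorth_empty v hzn, sub_zero,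
    partWorth_compOf]

end HGGame
end
end

section
/- The position value satisfies partial balanced conference contributions: for any hypergraph communication situation (N,v,H) and any two players i,j∈N, Σ_{e∈H_j}(1/|e|)·[π_i(N,v,H)−π_i(N,v,H\{e})] = Σ_{e∈H_i}(1/|e|)·[π_j(N,v,H)−π_j(N,v,H\{e})]. -/
open scoped Classical
open Finset

noncomputable section

namespace HGGame

/-! ## Generic hypergraph notions -/

variable {α : Type*}

/-! ## Hypergraph communication situations -/

variable {N : Type*} [Fintype N] [DecidableEq N]

/-! ## The Shapley value through coalitions and its potential -/

section Shapley

variable {M : Type*} [Fintype M]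

lemma card_preceding (σ : M ≃ Fin (Fintype.card M)) (a : M) : #(preceding σ a) = σ a := by
  have h : (preceding σ a).map σ.toEmbedding = Finset.Iio (σ a) := by
    ext k
    simp only [preceding, Finset.mem_map_equiv, Finset.mem_filter, Finset.mem_univ, true_and,
      Equiv.apply_symm_apply, Finset.mem_Iio]
  rw [← Finset.card_map σ.toEmbedding, h, Fin.card_Iio]

lemma preceding_eq_iff (σ : M ≃ Fin (Fintype.card M)) (a : M) (T : Finset M) :
    preceding σ a = T ↔ Numbering.IsPrefix σ T ∧ (σ a : ℕ) = #T := by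
  constructor
  · rintro rfl
    refine ⟨fun x => ?_, (card_preceding σ a).symm⟩
    rw [card_preceding]
    simp [preceding]
  · rintro ⟨h, ha⟩
    ext x
    rw [h x, ← ha]
    simp [preceding]

/-- The orderings in which the players preceding `a` are exactly those of `T`. -/
def orderingsPreceded (T : Finset M) (a : M) : Finset (M ≃ Fin (Fintype.card M)) :=
  Finset.univ.filter fun σ => preceding σ a = T

lemma card_orderingsPreceded_le {T : Finset M} {a b : M} (ha : a ∉ T) (hb : b ∉ T) :
    #(orderingsPreceded T a) ≤ #(orderingsPreceded T b) := by
  refine Finset.card_le_card_of_injOn (fun σ => (Equiv.swap a b).trans σ) ?_ ?_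
  · intro σ hσ
    simp only [orderingsPreceded, Finset.coe_filter, Finset.mem_univ, true_and,
      Set.mem_ofPred_eq] at hσ ⊢
    rw [preceding_eq_iff] at hσ ⊢
    refine ⟨fun x => ?_, by simpa using hσ.2⟩
    rw [Equiv.trans_apply, ← hσ.1]
    by_cases hxa : x = a
    · subst hxa; simp [ha, hb]
    by_cases hxb : x = b
    · subst hxb; simp [ha, hb]
    rw [Equiv.swap_apply_of_ne_of_ne hxa hxb]
  · intro σ _ τ _ h
    ext x
    have := DFunLike.congr_fun h (Equiv.swap a b x)
    simpa using congrArg Fin.val this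

lemma sum_card_orderingsPreceded {T : Finset M} (hT : #T < Fintype.card M) :
    ∑ a ∈ Tᶜ, #(orderingsPreceded T a) = (#T).factorial * (Fintype.card M - #T).factorial := by
  rw [← Numbering.card_prefixed, ← Finset.card_biUnion]
  · congr 1
    ext σ
    simp only [orderingsPreceded, Finset.mem_biUnion, Finset.mem_filter, Finset.mem_univ, true_and,
      Numbering.mem_prefixed, preceding_eq_iff, Finset.mem_compl]
    constructor
    · rintro ⟨a, -, h, -⟩
      exact h
    · intro h
      refine ⟨σ.symm ⟨#T, hT⟩, ?_, h, by simp⟩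
      rw [h]
      simp
  · intro a _ b _ hab
    rw [Function.onFun, Finset.disjoint_left]
    intro σ ha hb
    simp only [orderingsPreceded, Finset.mem_filter, Finset.mem_univ, true_and,
      preceding_eq_iff] at ha hb
    exact hab (σ.injective (Fin.ext (ha.2.trans hb.2.symm)))

lemma card_orderingsPreceded {T : Finset M} {a : M} (ha : a ∉ T) :
    #(orderingsPreceded T a) = (#T).factorial * (Fintype.card M - 1 - #T).factorial := by
  have hT : #T < Fintype.card M := Finset.card_lt_univ_of_notMem ha
  have h := sum_card_orderingsPreceded hT
  rw [Finset.sum_congr rfl fun b hb => le_antisymm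
    (card_orderingsPreceded_le (Finset.mem_compl.1 hb) ha)
    (card_orderingsPreceded_le ha (Finset.mem_compl.1 hb)), Finset.sum_const, Finset.card_compl,
    smul_eq_mul] at h
  obtain ⟨k, hk⟩ : ∃ k, Fintype.card M - #T = k + 1 := ⟨Fintype.card M - #T - 1, by omega⟩
  rw [hk, Nat.factorial_succ] at h
  rw [show Fintype.card M - 1 - #T = k by omega]
  refine Nat.eq_of_mul_eq_mul_left (Nat.succ_pos k) ?_
  rw [Nat.succ_eq_add_one, h]
  ring

/-- The Shapley value as a weighted sum of marginal contributions over coalitions. -/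
lemma shapley_eq_sum (u : Finset M → ℝ) (a : M) :
    shapley u a = ∑ T : Finset M with a ∉ T,
      ((#T).factorial * (Fintype.card M - 1 - #T).factorial / (Fintype.card M).factorial : ℝ) *
        (u (insert a T) - u T) := by
  have h : ∀ σ ∈ (Finset.univ : Finset (M ≃ Fin (Fintype.card M))),
      preceding σ a ∈ (Finset.univ : Finset (Finset M)).filter fun T => a ∉ T := by
    intro σ _
    simp [preceding]
  rw [shapley, ← Finset.sum_fiberwise_of_maps_to h, Finset.mul_sum]
  refine Finset.sum_congr rfl fun T hT => ?_
  have hc := card_orderingsPreceded (Finset.mem_filter.1 hT).2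
  rw [orderingsPreceded] at hc
  rw [Finset.sum_congr rfl (g := fun _ => u (insert a T) - u T), Finset.sum_const, hc,
    nsmul_eq_mul]
  · push_cast
    ring
  · intro σ hσ
    rw [marginal, (Finset.mem_filter.1 hσ).2]

end Shapley

/-- The potential of the subgame of `u` on the player set `S`. -/
def potential (u : Finset α → ℝ) (S : Finset α) : ℝ :=
  ∑ T ∈ S.powerset,
    ((#T - 1).factorial * (#S - #T).factorial / (#S).factorial : ℝ) * (u T - u ∅)

lemma potential_insert_sub (u : Finset α → ℝ) {R : Finset α} {a : α} (ha : a ∉ R) :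
    potential u (insert a R) - potential u R = ∑ T ∈ R.powerset,
      ((#T).factorial * (#R - #T).factorial / (#R + 1).factorial : ℝ) *
        (u (insert a T) - u T) := by
  rw [potential, potential, Finset.sum_powerset_insert ha, ← Finset.sum_add_distrib,
    ← Finset.sum_sub_distrib]
  refine Finset.sum_congr rfl fun T hT => ?_
  have hTR := Finset.mem_powerset.1 hT
  have hle := Finset.card_le_card hTR
  rw [Finset.card_insert_of_notMem ha, Finset.card_insert_of_notMem fun h => ha (hTR h)]
  obtain rfl | hne := T.eq_empty_or_nonempty
  · simp
  obtain ⟨t, ht⟩ : ∃ t, #T = t + 1 := ⟨#T - 1, by have := hne.card_pos; omega⟩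
  obtain ⟨d, hd⟩ : ∃ d, #R = t + 1 + d := ⟨#R - (t + 1), by omega⟩
  rw [ht, hd, show t + 1 + d + 1 - (t + 1) = d + 1 by omega,
    show t + 1 + d + 1 - (t + 1 + 1) = d by omega, show t + 1 + d - (t + 1) = d by omega,
    Nat.factorial_succ (t + 1 + d), Nat.factorial_succ d]
  simp only [Nat.add_sub_cancel, Nat.factorial_succ t]
  have := Nat.factorial_ne_zero (t + 1 + d)
  push_cast
  field_simp
  ring

/-- The Shapley value is the increment of the potential. -/
lemma shapley_eq_potential_sub (u : Finset α → ℝ) (S : Finset α) (a : {x // x ∈ S}) :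
    shapley (fun F : Finset {x // x ∈ S} => u (F.image Subtype.val)) a =
      potential u S - potential u (S.erase a) := by
  have h := potential_insert_sub u (Finset.notMem_erase a.1 S)
  rw [Finset.insert_erase a.2] at h
  rw [h, shapley_eq_sum]
  have hpos : 0 < #S := Finset.card_pos.2 ⟨a, a.2⟩
  refine Finset.sum_bij' (fun T _ => T.image Subtype.val) (fun T _ => T.subtype (· ∈ S))
    ?_ ?_ ?_ ?_ ?_
  · intro T hT
    simp only [Finset.mem_filter, Finset.mem_univ, true_and] at hT
    simp only [Finset.mem_powerset, Finset.subset_iff, Finset.mem_image, Finset.mem_erase]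
    rintro _ ⟨x, hx, rfl⟩
    exact ⟨fun h => hT (Subtype.ext h ▸ hx), x.2⟩
  · intro T hT
    simp only [Finset.mem_filter, Finset.mem_univ, true_and, Finset.mem_subtype]
    exact fun h => Finset.notMem_erase _ _ (Finset.mem_powerset.1 hT h)
  · intro T _
    ext x
    simp
  · intro T hT
    ext x
    simpa using fun hx => Finset.mem_of_mem_erase (Finset.mem_powerset.1 hT hx)
  · intro T _
    have himage : (insert a T).image Subtype.val = insert a.1 (T.image Subtype.val) := by
      ext x
      simp only [Finset.mem_image, Finset.mem_insert, exists_eq_or_imp, eq_comm (a := x)]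
    rw [Finset.card_image_of_injective _ Subtype.val_injective, Finset.card_erase_of_mem a.2,
      Nat.sub_add_cancel hpos, Fintype.card_coe, ← himage]
    congr!

lemma positionValue_eq_sum_potential (v : Finset N → ℝ) (H : Finset (Finset N)) (i : N) :
    positionValue v H i = ∑ e ∈ H with i ∈ e, (#e : ℝ)⁻¹ *
      (potential (fun E => restrictedWorth v E Finset.univ) H -
        potential (fun E => restrictedWorth v E Finset.univ) (H.erase e)) := by
  rw [positionValue, Finset.sum_filter, Finset.sum_filter, ← Finset.sum_attach H]
  refine Finset.sum_congr rfl fun e _ => ?_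
  have h := shapley_eq_potential_sub (fun E => restrictedWorth v E Finset.univ) H e
  split_ifs
  · congr 1
    unfold confGame
    convert h
  · rfl

lemma positionValue_erase_eq_sum_potential (v : Finset N → ℝ) (H : Finset (Finset N))
    (f : Finset N) (i : N) :
    positionValue v (H.erase f) i = ∑ e ∈ H with i ∈ e, (#e : ℝ)⁻¹ *
      (potential (fun E => restrictedWorth v E Finset.univ) (H.erase f) -
        potential (fun E => restrictedWorth v E Finset.univ) ((H.erase f).erase e)) := by
  rw [positionValue_eq_sum_potential]
  refine Finset.sum_subset (Finset.filter_subset_filter _ (Finset.erase_subset _ _)) ?_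
  intro e he hne
  have hef : e = f := by
    by_contra h
    simp_all
  subst hef
  simp

/-- Partial balanced conference contributions of the position value. -/
theorem position_value_partial_balanced_conference_contributions
    {N : Type*} [Fintype N] [DecidableEq N]
    (v : Finset N → ℝ) (H : Finset (Finset N))
    (hN : 2 ≤ Fintype.card N)
    (hv0 : v ∅ = 0) (hzn : ∀ i : N, v {i} = 0)
    (hH : ∀ e ∈ H, 1 < e.card) (i j : N) :
    ∑ e ∈ H.filter (fun e => j ∈ e), (e.card : ℝ)⁻¹ *
        (positionValue v H i - positionValue v (H.erase e) i)
      = ∑ e ∈ H.filter (fun e => i ∈ e), (e.card : ℝ)⁻¹ *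
        (positionValue v H j - positionValue v (H.erase e) j) := by
  simp only [positionValue_erase_eq_sum_potential, positionValue_eq_sum_potential v H,
    ← Finset.sum_sub_distrib, Finset.mul_sum]
  rw [Finset.sum_comm]
  refine Finset.sum_congr rfl fun e _ => Finset.sum_congr rfl fun f _ => ?_
  rw [Finset.erase_right_comm (a := f) (b := e)]
  ring

end HGGame
end
end
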